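/- Let 2 ≤ j < j_m. If α ≥ 1, β ∈ ℝ and χ_{j0}(α,β) ≠ 0 (the case k = 0), then 1 ≤ α ≤ 2·M^{2j} and (4M³)^{−1}·M^{2j} ≤ 1+β² ≤ 4M³·M^{2j}. -/

import Mathlib

open MeasureTheory Filter Set

noncomputable section

/-- The temperature scale `j_m = 1 + ⌊log(1/T)/log M⌋`. -/
def jmax (M T : ℝ) : ℕ := 1 + ⌊Real.log (1 / T) / Real.log M⌋₊

/-- The maximal auxiliary scale `k_m(j) = min(j_m − j, 3j)`. -/
def kmax (M T : ℝ) (j : ℕ) : ℕ := min (jmax M T - j) (3 * j)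

/-- `X_{αβ} = (1+β²)^{3/4}·(α+β²)^{1/4}`. -/
def Xab (α β : ℝ) : ℝ := (1 + β ^ 2) ^ ((3:ℝ)/4) * (α + β ^ 2) ^ ((1:ℝ)/4)

/-- The main slice cutoff `χ_j`: `χ_0(X) = u(X)`;
`χ_j(X) = u(X/M^{2j}) − u(X/M^{2j−2})` for `0 < j < j_m`;
`χ_{j_m}(X) = 1 − u(X/M^{2j_m−2})`. -/
def chiMain (u : ℝ → ℝ) (M : ℝ) (jm j : ℕ) (X : ℝ) : ℝ :=
  if j = 0 then u X
  else if j = jm then 1 - u (X / M ^ (2 * jm - 2))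
  else u (X / M ^ (2 * j)) - u (X / M ^ (2 * j - 2))

/-- The auxiliary slice cutoff `χ̃_k` (at main scale `j`): if `k_m(j) = 0` then `χ̃_0 ≡ 1`;
otherwise `χ̃_0(α) = u(α/M^{2j})`, `χ̃_k(α) = u(α/M^{2j+2k}) − u(α/M^{2j+2k−2})` for
`0 < k < k_m(j)` and `χ̃_{k_m(j)}(α) = 1 − u(α/M^{2j+2k_m(j)})`. -/
def chiAux (u : ℝ → ℝ) (M T : ℝ) (j k : ℕ) (α : ℝ) : ℝ :=
  if kmax M T j = 0 then 1
  else if k = 0 then u (α / M ^ (2 * j))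
  else if k = kmax M T j then 1 - u (α / M ^ (2 * j + 2 * kmax M T j))
  else u (α / M ^ (2 * j + 2 * k)) - u (α / M ^ (2 * j + 2 * k - 2))

/-- `χ_{jk}(α,β) = χ_j(X_{αβ})·χ̃_k(α)`. -/
def chiJK (u : ℝ → ℝ) (M T : ℝ) (j k : ℕ) (α β : ℝ) : ℝ :=
  chiMain u M (jmax M T) j (Xab α β) * chiAux u M T j k α

lemma kmax_ne_zero {M T : ℝ} {j : ℕ} (hj : 0 < j) (hjm : j < jmax M T) :
    kmax M T j ≠ 0 := by
  unfold kmax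
  omega

lemma Xab_nonneg {α : ℝ} (hα : 1 ≤ α) (β : ℝ) : 0 ≤ Xab α β := by
  unfold Xab
  positivity

lemma Xab_pow_four {α : ℝ} (hα : 1 ≤ α) (β : ℝ) :
    Xab α β ^ 4 = (1 + β ^ 2) ^ 3 * (α + β ^ 2) := by
  have h1 : (0 : ℝ) ≤ 1 + β ^ 2 := by positivity
  have h2 : (0 : ℝ) ≤ α + β ^ 2 := by positivity
  unfold Xab
  rw [mul_pow, ← Real.rpow_mul_natCast h1, ← Real.rpow_mul_natCast h2]
  norm_num

lemma one_add_sq_le_Xab {α : ℝ} (hα : 1 ≤ α) (β : ℝ) : 1 + β ^ 2 ≤ Xab α β := by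
  refine le_of_pow_le_pow_left₀ four_ne_zero (Xab_nonneg hα β) ?_
  rw [Xab_pow_four hα, pow_succ (1 + β ^ 2) 3]
  gcongr

/-- An intermediate slice cutoff is supported in `(M^{2j-2}, 2 M^{2j})`. -/
lemma mem_Ioo_of_chiMain_ne_zero {u : ℝ → ℝ} {M X : ℝ} {jm j : ℕ} (hM : 1 ≤ M)
    (hu1 : ∀ x : ℝ, x ≤ 1 → u x = 1) (hu2 : ∀ x : ℝ, 2 ≤ x → u x = 0)
    (hj : 0 < j) (hjm : j < jm) (hX : chiMain u M jm j X ≠ 0) :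
    X ∈ Ioo (M ^ (2 * j - 2)) (2 * M ^ (2 * j)) := by
  have hle : M ^ (2 * j - 2) ≤ M ^ (2 * j) := pow_le_pow_right₀ hM (Nat.sub_le _ _)
  have hP : 0 < M ^ (2 * j - 2) := by positivity
  have hN : 0 < M ^ (2 * j) := by positivity
  rw [chiMain, if_neg hj.ne', if_neg hjm.ne] at hX
  constructor
  · by_contra! h
    exact hX (by rw [hu1 _ ((div_le_one hN).2 (h.trans hle)), hu1 _ ((div_le_one hP).2 h), sub_self])
  · by_contra! h
    refine hX ?_
    rw [hu2 _ ((le_div_iff₀ hN).2 h), hu2 _ ((le_div_iff₀ hP).2 (by linarith)), sub_self]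

/-- let `2 ≤ j < j_m`. If `α ≥ 1`, `β ∈ ℝ` and `χ_{j0}(α,β) ≠ 0`
(the case `k = 0`), then `1 ≤ α ≤ 2·M^{2j}` and `(4M³)^{−1}·M^{2j} ≤ 1+β² ≤ 4M³·M^{2j}`. -/
theorem slicing_support_k_zero (M T : ℝ) (hM : 2 ≤ M) (hT0 : 0 < T) (hT1 : T ≤ 1)
    (u : ℝ → ℝ) (hu01 : ∀ x, 0 ≤ u x ∧ u x ≤ 1)
    (hu1 : ∀ x : ℝ, x ≤ 1 → u x = 1) (hu2 : ∀ x : ℝ, 2 ≤ x → u x = 0)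
    (j : ℕ) (hj2 : 2 ≤ j) (hjm : j < jmax M T)
    (α β : ℝ) (hα : 1 ≤ α) (hchi : chiJK u M T j 0 α β ≠ 0) :
    (1 ≤ α ∧ α ≤ 2 * M ^ (2 * j)) ∧
    ((4 * M ^ 3)⁻¹ * M ^ (2 * j) ≤ 1 + β ^ 2 ∧ 1 + β ^ 2 ≤ 4 * M ^ 3 * M ^ (2 * j)) := by
  obtain ⟨hmain, haux⟩ := mul_ne_zero_iff.1 hchi
  have hj : 0 < j := by omega
  have hM1 : 1 ≤ M := by linarith
  obtain ⟨hXlo, hXhi⟩ := mem_Ioo_of_chiMain_ne_zero hM1 hu1 hu2 hj hjm hmain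
  rw [chiAux, if_neg (kmax_ne_zero hj hjm), if_pos rfl] at haux
  have hN : 0 < M ^ (2 * j) := by positivity
  have hα2 : α ≤ 2 * M ^ (2 * j) := by
    by_contra! h
    exact haux (hu2 _ ((le_div_iff₀ hN).2 h.le))
  have hM3 : 8 ≤ M ^ 3 := by
    calc (8 : ℝ) = 2 ^ 3 := by norm_num
      _ ≤ M ^ 3 := by gcongr
  refine ⟨⟨hα, hα2⟩, ?_, ?_⟩
  · have hsplit : M ^ (2 * j) = M ^ 2 * M ^ (2 * j - 2) := by
      rw [← pow_add]
      congr 1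
      omega
    have hX4 : (M ^ (2 * j - 2)) ^ 4 < (1 + β ^ 2) ^ 3 * (α + β ^ 2) := by
      rw [← Xab_pow_four hα]
      gcongr
    by_contra! h
    rw [inv_mul_eq_div, lt_div_iff₀ (by positivity)] at h
    generalize M ^ (2 * j) = N at *
    generalize M ^ (2 * j - 2) = P at *
    have hsum : α + β ^ 2 ≤ 3 * N := by nlinarith [sq_nonneg β]
    have hcube : ((1 + β ^ 2) * (4 * M ^ 3)) ^ 3 ≤ N ^ 3 := by gcongr
    have hlow : 64 * M ^ 9 * P ^ 4 < 3 * N ^ 4 := by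
      calc 64 * M ^ 9 * P ^ 4 < 64 * M ^ 9 * ((1 + β ^ 2) ^ 3 * (α + β ^ 2)) := by gcongr
        _ = ((1 + β ^ 2) * (4 * M ^ 3)) ^ 3 * (α + β ^ 2) := by ring
        _ ≤ N ^ 3 * (3 * N) := by gcongr
        _ = 3 * N ^ 4 := by ring
    have hid : M * N ^ 4 = M ^ 9 * P ^ 4 := by rw [hsplit]; ring
    have hN4 : 0 < N ^ 4 := by positivity
    nlinarith
  · have hA := one_add_sq_le_Xab hα β
    nlinarith
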